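/- Let π be a Generalized Lakshmibai–Seshadri path of shape λ ∈ P^+, i ∈ I^{re}, and t_0 ∈ (0,1) a point at which h_i^π attains a left local minimum (i.e. there is ε > 0 such that h_i^π is strictly decreasing on [t_0 − ε, t_0] and increasing on [t_0, t_0 + ε]). Then h_i^π(t_0) ∈ ℤ. The same conclusion holds for a right local minimum (h_i^π decreasing on [t_0 − ε, t_0], strictly increasing on [t_0, t_0 + ε]). Consequently every GLS path π is integral: for every i ∈ I, the minimum value of h_i^π on [0,1] is an integer, i.e. equals m_i^π. -/

import Mathlib

namespace GKM

variable {I V : Type*} [AddCommGroup V] [Module ℚ V]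

/-- The simple "reflection" `r_i : x ↦ x - α_i^∨(x) • α_i` (an endomorphism of `h*`). -/
def srefl (α : I → V) (coroot : I → (V →ₗ[ℚ] ℚ)) (i : I) : Module.End ℚ V :=
  LinearMap.id - (coroot i).smulRight (α i)

/-- The dual map `h ↦ h - h(α_i) • α_i^∨` on linear functionals; for a real index `i`
this is `r_i^∨ : h ↦ h ∘ r_i⁻¹ = h ∘ r_i`. -/
def crefl (α : I → V) (coroot : I → (V →ₗ[ℚ] ℚ)) (i : I) :
    Module.End ℚ (V →ₗ[ℚ] ℚ) :=
  LinearMap.id - (LinearMap.applyₗ (α i)).smulRight (coroot i)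

/-- The monoid `T` generated by all the `r_i`, `i ∈ I`. -/
def Tmon (α : I → V) (coroot : I → (V →ₗ[ℚ] ℚ)) : Submonoid (Module.End ℚ V) :=
  Submonoid.closure (Set.range (srefl α coroot))

/-- The Weyl group `W` generated by the `r_i` with `i` real; since each generator is an
involution, the submonoid it generates coincides with the group it generates. -/
def Wmon (A : I → I → ℤ) (α : I → V) (coroot : I → (V →ₗ[ℚ] ℚ)) :
    Submonoid (Module.End ℚ V) :=
  Submonoid.closure (srefl α coroot '' {i | A i i = 2})

/-- `Q^+`, the set of `ℕ`-linear combinations of simple roots. -/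
def Qplus (α : I → V) : Set V :=
  {x | ∃ c : I →₀ ℕ, x = c.sum fun i n => (n : ℚ) • α i}

/-- The weight lattice `P`. -/
def Pint (coroot : I → (V →ₗ[ℚ] ℚ)) : Set V :=
  {x | ∀ i, ∃ n : ℤ, coroot i x = (n : ℚ)}

/-- The dominant integral weights `P^+`. -/
def Pplus (coroot : I → (V →ₗ[ℚ] ℚ)) : Set V :=
  {x | (∀ i, ∃ n : ℤ, coroot i x = (n : ℚ)) ∧ ∀ i, 0 ≤ coroot i x}

/-- The orbit `Tλ`. -/
def Torbit (α : I → V) (coroot : I → (V →ₗ[ℚ] ℚ)) (lam : V) : Set V :=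
  {x | ∃ τ, τ ∈ Tmon α coroot ∧ τ lam = x}

/-- The reduced length of `τ ∈ T` with respect to all generators `r_i`, `i ∈ I`. -/
noncomputable def lenT (α : I → V) (coroot : I → (V →ₗ[ℚ] ℚ))
    (τ : Module.End ℚ V) : ℕ :=
  sInf {n | ∃ l : List I, l.length = n ∧ (l.map (srefl α coroot)).prod = τ}

/-- The reduced length of `w ∈ W` with respect to the real generators. -/
noncomputable def lenW (A : I → I → ℤ) (α : I → V) (coroot : I → (V →ₗ[ℚ] ℚ))
    (w : Module.End ℚ V) : ℕ :=
  sInf {n | ∃ l : List I, (∀ m ∈ l, A m m = 2) ∧ l.length = n ∧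
    (l.map (srefl α coroot)).prod = w}

/-- The reflection `r_β : x ↦ x - β^∨(x) • β` attached to a root/coroot pair. -/
def reflRoot (β : V) (βv : V →ₗ[ℚ] ℚ) : Module.End ℚ V :=
  LinearMap.id - βv.smulRight β

/-- A presentation of `β = w α_k ∈ WΠ` together with its coroot `β^∨ = w^∨ α_k^∨`,
via a word `l` (with real entries) for `w`. -/
def IsWRootPres (A : I → I → ℤ) (α : I → V) (coroot : I → (V →ₗ[ℚ] ℚ))
    (l : List I) (k : I) (β : V) (βv : V →ₗ[ℚ] ℚ) : Prop :=
  (∀ m ∈ l, A m m = 2) ∧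
  β = (l.map (srefl α coroot)).prod (α k) ∧
  βv = (l.map (crefl α coroot)).prod (coroot k)

/-- `β ∈ WΠ` with coroot `β^∨`. -/
def IsWRootPair (A : I → I → ℤ) (α : I → V) (coroot : I → (V →ₗ[ℚ] ℚ))
    (β : V) (βv : V →ₗ[ℚ] ℚ) : Prop :=
  ∃ l k, IsWRootPres A α coroot l k β βv

/-- A chain `ν =: c s ← ⋯ ← c 0 := μ` of length `s` inside `Tλ`:
`c k = r_{β k} (c (k+1))` with `β k ∈ WΠ ∩ Q^+` and `(β k)^∨(c (k+1)) > 0`. -/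
def IsChain (A : I → I → ℤ) (α : I → V) (coroot : I → (V →ₗ[ℚ] ℚ))
    (lam μ ν : V) (s : ℕ) (c : ℕ → V) (β : ℕ → V)
    (βv : ℕ → (V →ₗ[ℚ] ℚ)) : Prop :=
  c 0 = μ ∧ c s = ν ∧ (∀ k ≤ s, c k ∈ Torbit α coroot lam) ∧
  ∀ k < s, IsWRootPair A α coroot (β k) (βv k) ∧ β k ∈ Qplus α ∧
    0 < βv k (c (k+1)) ∧ c k = c (k+1) - βv k (c (k+1)) • β k

/-- `μ > ν` in `Tλ`. -/
def ChainGT (A : I → I → ℤ) (α : I → V) (coroot : I → (V →ₗ[ℚ] ℚ))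
    (lam μ ν : V) : Prop :=
  ∃ s, 1 ≤ s ∧ ∃ c β βv, IsChain A α coroot lam μ ν s c β βv

/-- `dist(μ, ν) = n`: there is a chain of length `n` from `μ` to `ν` and every chain
has length at most `n`. -/
def distEq (A : I → I → ℤ) (α : I → V) (coroot : I → (V →ₗ[ℚ] ℚ))
    (lam μ ν : V) (n : ℕ) : Prop :=
  (∃ c β βv, IsChain A α coroot lam μ ν n c β βv) ∧
  ∀ m c β βv, IsChain A α coroot lam μ ν m c β βv → m ≤ n

/-- An `a`-chain for `(μ, ν)`: a chain in which each step is a covering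
(`dist = 1`), `a·β_k^∨(ν_k)` is a positive integer for steps along `WΠ_re`,
and `a·β_k^∨(ν_k) = 1` for steps along `WΠ_im`.  The index `ks k` records the simple
root of which `β k` is a `W`-translate. -/
def IsAChain (A : I → I → ℤ) (α : I → V) (coroot : I → (V →ₗ[ℚ] ℚ))
    (lam : V) (a : ℚ) (μ ν : V) (s : ℕ) (c : ℕ → V)
    (β : ℕ → V) (βv : ℕ → (V →ₗ[ℚ] ℚ)) (ks : ℕ → I) : Prop :=
  1 ≤ s ∧ IsChain A α coroot lam μ ν s c β βv ∧
  ∀ k < s,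
    (∃ l, IsWRootPres A α coroot l (ks k) (β k) (βv k)) ∧
    distEq A α coroot lam (c k) (c (k+1)) 1 ∧
    (A (ks k) (ks k) = 2 → ∃ n : ℕ, 0 < n ∧ a * βv k (c (k+1)) = (n : ℚ)) ∧
    (A (ks k) (ks k) ≠ 2 → a * βv k (c (k+1)) = 1)

/-- Existence of an `a`-chain for `(μ, ν)`. -/
def HasAChain (A : I → I → ℤ) (α : I → V) (coroot : I → (V →ₗ[ℚ] ℚ))
    (lam : V) (a : ℚ) (μ ν : V) : Prop :=
  ∃ s c β βv ks, IsAChain A α coroot lam a μ ν s c β βv ks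

/-- The piecewise-linear path attached to GLS data `(λ_1, …, λ_s ; a_0, …, a_s)`
(weights indexed `1, …, s`, breakpoints indexed `0, …, s`):
on `[a_{j-1}, a_j]` it equals `Σ_{k<j} (a_k - a_{k-1}) • λ_k + (t - a_{j-1}) • λ_j`. -/
def glsPath (lamseq : ℕ → V) (a : ℕ → ℚ) (s : ℕ) (t : ℚ) : V :=
  ∑ k ∈ Finset.range s, (max (min t (a (k+1)) - a k) 0) • lamseq (k+1)

/-- The data of a Generalized Lakshmibai–Seshadri path of shape `lam`. -/
def IsGLS (A : I → I → ℤ) (α : I → V) (coroot : I → (V →ₗ[ℚ] ℚ))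
    (lam : V) (s : ℕ) (lamseq : ℕ → V) (a : ℕ → ℚ) : Prop :=
  1 ≤ s ∧ a 0 = 0 ∧ a s = 1 ∧ (∀ k < s, a k < a (k+1)) ∧
  (∀ k, 1 ≤ k → k ≤ s → lamseq k ∈ Torbit α coroot lam) ∧
  (∀ k, 1 ≤ k → k < s →
    HasAChain A α coroot lam (a k) (lamseq k) (lamseq (k+1))) ∧
  (lamseq s = lam ∨ HasAChain A α coroot lam 1 (lamseq s) lam)

/-- The set `ℙ_λ` of Generalized Lakshmibai–Seshadri paths of shape `lam`,
realized as functions `ℚ → V` via `glsPath`. -/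
def GLSset (A : I → I → ℤ) (α : I → V) (coroot : I → (V →ₗ[ℚ] ℚ))
    (lam : V) : Set (ℚ → V) :=
  {π | ∃ s lamseq a, IsGLS A α coroot lam s lamseq a ∧ π = glsPath lamseq a s}

/-- `h_i^π(t) = α_i^∨(π(t))`. -/
def hFun (coroot : I → (V →ₗ[ℚ] ℚ)) (i : I) (π : ℚ → V) (t : ℚ) : ℚ :=
  coroot i (π t)

/-- `m_i^π`, the minimal integer value attained by `h_i^π` on `[0,1]`. -/
noncomputable def mOf (coroot : I → (V →ₗ[ℚ] ℚ)) (i : I) (π : ℚ → V) : ℤ :=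
  sInf {n : ℤ | ∃ t, 0 ≤ t ∧ t ≤ 1 ∧ hFun coroot i π t = (n : ℚ)}

/-- Two paths agree on `[0,1]`. -/
def pathEq (π π' : ℚ → V) : Prop := ∀ t, 0 ≤ t → t ≤ 1 → π t = π' t

/-- `tp = f_+^i(π)`: the largest point of `[0,1]` where `h_i^π` equals `m_i^π`. -/
def IsFPlus (coroot : I → (V →ₗ[ℚ] ℚ)) (i : I) (π : ℚ → V) (tp : ℚ) : Prop :=
  0 ≤ tp ∧ tp ≤ 1 ∧ hFun coroot i π tp = (mOf coroot i π : ℚ) ∧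
  ∀ t, 0 ≤ t → t ≤ 1 → hFun coroot i π t = (mOf coroot i π : ℚ) → t ≤ tp

/-- `tm = f_-^i(π)`: the smallest point of `[tp,1]` where `h_i^π` equals `m_i^π + 1`. -/
def IsFMinus (coroot : I → (V →ₗ[ℚ] ℚ)) (i : I) (π : ℚ → V) (tp tm : ℚ) : Prop :=
  tp ≤ tm ∧ tm ≤ 1 ∧ hFun coroot i π tm = (mOf coroot i π : ℚ) + 1 ∧
  ∀ t, tp ≤ t → t ≤ 1 → hFun coroot i π t = (mOf coroot i π : ℚ) + 1 → tm ≤ t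

/-- The path `f_i π` (for cutting data `tp = f_+^i(π)`, `tm = f_-^i(π)`). -/
def fPath (α : I → V) (coroot : I → (V →ₗ[ℚ] ℚ)) (i : I) (tp tm : ℚ)
    (π : ℚ → V) (t : ℚ) : V :=
  if t ≤ tp then π t
  else if t ≤ tm then π tp + srefl α coroot i (π t - π tp)
  else π t - α i

/-- `π' = f_i π ≠ 0` (equality of paths on `[0,1]`). -/
def FRel (α : I → V) (coroot : I → (V →ₗ[ℚ] ℚ)) (i : I) (π π' : ℚ → V) : Prop :=
  ∃ tp tm, IsFPlus coroot i π tp ∧ tp < 1 ∧ IsFMinus coroot i π tp tm ∧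
    pathEq π' (fPath α coroot i tp tm π)

/-- `tp = e_+^i(π)` (`i` real): smallest point of `[0,1]` where `h_i^π = m_i^π`. -/
def IsEPlusRe (coroot : I → (V →ₗ[ℚ] ℚ)) (i : I) (π : ℚ → V) (tp : ℚ) : Prop :=
  0 ≤ tp ∧ tp ≤ 1 ∧ hFun coroot i π tp = (mOf coroot i π : ℚ) ∧
  ∀ t, 0 ≤ t → t ≤ 1 → hFun coroot i π t = (mOf coroot i π : ℚ) → tp ≤ t

/-- `tm = e_-^i(π)` (`i` real): largest point of `[0,tp]` where `h_i^π = m_i^π + 1`. -/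
def IsEMinusRe (coroot : I → (V →ₗ[ℚ] ℚ)) (i : I) (π : ℚ → V) (tp tm : ℚ) : Prop :=
  0 ≤ tm ∧ tm ≤ tp ∧ hFun coroot i π tm = (mOf coroot i π : ℚ) + 1 ∧
  ∀ t, 0 ≤ t → t ≤ tp → hFun coroot i π t = (mOf coroot i π : ℚ) + 1 → t ≤ tm

/-- The path `e_i π` for `i` real. -/
def ePathRe (α : I → V) (coroot : I → (V →ₗ[ℚ] ℚ)) (i : I) (tm tp : ℚ)
    (π : ℚ → V) (t : ℚ) : V :=
  if t ≤ tm then π t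
  else if t ≤ tp then π tm + srefl α coroot i (π t - π tm)
  else π t + α i

/-- `π' = e_i π ≠ 0` for a real index `i`. -/
def ERelRe (α : I → V) (coroot : I → (V →ₗ[ℚ] ℚ)) (i : I) (π π' : ℚ → V) : Prop :=
  ∃ tp tm, IsEPlusRe coroot i π tp ∧ 0 < tp ∧ IsEMinusRe coroot i π tp tm ∧
    pathEq π' (ePathRe α coroot i tm tp π)

/-- The "inverse reflection" `r_i^{-1} : x ↦ x + (1/(1-a_{ii})) α_i^∨(x) α_i`
for an imaginary index `i`. -/
def rinv (A : I → I → ℤ) (α : I → V) (coroot : I → (V →ₗ[ℚ] ℚ)) (i : I) :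
    Module.End ℚ V :=
  LinearMap.id + (1 / (1 - (A i i : ℚ))) • (coroot i).smulRight (α i)

/-- `tp = e_+^i(π)` (`i` imaginary): smallest point of `[tm,1]` where
`h_i^π = m_i^π + 1 - a_{ii}` (here `tm = e_-^i(π) = f_+^i(π)`). -/
def IsEPlusIm (A : I → I → ℤ) (coroot : I → (V →ₗ[ℚ] ℚ)) (i : I) (π : ℚ → V)
    (tm tp : ℚ) : Prop :=
  tm ≤ tp ∧ tp ≤ 1 ∧
  hFun coroot i π tp = (mOf coroot i π : ℚ) + 1 - (A i i : ℚ) ∧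
  ∀ t, tm ≤ t → t ≤ 1 →
    hFun coroot i π t = (mOf coroot i π : ℚ) + 1 - (A i i : ℚ) → tp ≤ t

/-- The path `e_i π` for `i` imaginary. -/
def ePathIm (A : I → I → ℤ) (α : I → V) (coroot : I → (V →ₗ[ℚ] ℚ)) (i : I)
    (tm tp : ℚ) (π : ℚ → V) (t : ℚ) : V :=
  if t ≤ tm then π t
  else if t ≤ tp then π tm + rinv A α coroot i (π t - π tm)
  else π t + α i

/-- `π' = e_i π ≠ 0` for an imaginary index `i`:  `e_-^i(π) = f_+^i(π) < 1`, the point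
`e_+^i(π)` exists, and `h_i^π` never drops to `m_i^π - a_{ii}` on `[e_+^i(π), 1]`. -/
def ERelIm (A : I → I → ℤ) (α : I → V) (coroot : I → (V →ₗ[ℚ] ℚ)) (i : I)
    (π π' : ℚ → V) : Prop :=
  ∃ tm tp, IsFPlus coroot i π tm ∧ tm < 1 ∧ IsEPlusIm A coroot i π tm tp ∧
    (∀ t, tp ≤ t → t ≤ 1 →
      (mOf coroot i π : ℚ) - (A i i : ℚ) < hFun coroot i π t) ∧
    pathEq π' (ePathIm A α coroot i tm tp π)

/-- `π' = e_i π ≠ 0`. -/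
def ERel (A : I → I → ℤ) (α : I → V) (coroot : I → (V →ₗ[ℚ] ℚ)) (i : I)
    (π π' : ℚ → V) : Prop :=
  (A i i = 2 ∧ ERelRe α coroot i π π') ∨ (A i i ≠ 2 ∧ ERelIm A α coroot i π π')

/-- `π' = f_{i_1} ⋯ f_{i_k} π ≠ 0` for a list `[i_1, …, i_k]` (rightmost acts first). -/
def FMonRel (α : I → V) (coroot : I → (V →ₗ[ℚ] ℚ)) :
    List I → (ℚ → V) → (ℚ → V) → Prop
  | [], π, π' => pathEq π π'
  | i :: l, π, π' => ∃ πm, FMonRel α coroot l π πm ∧ FRel α coroot i πm π'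

/-- A generalized crystal for the Borcherds–Cartan datum `(A, α, coroot)`. -/
structure GenCrystal (A : I → I → ℤ) (α : I → V)
    (coroot : I → (V →ₗ[ℚ] ℚ)) where
  B : Type*
  wt : B → V
  wt_int : ∀ (i : I) (b : B), ∃ n : ℤ, coroot i (wt b) = (n : ℚ)
  eps : I → B → WithBot ℤ
  phi : I → B → WithBot ℤ
  e : I → B → Option B
  f : I → B → Option B
  phi_eq : ∀ (i : I) (b : B) (n : ℤ), (n : ℚ) = coroot i (wt b) →
    phi i b = eps i b + (n : WithBot ℤ)
  wt_e : ∀ (i : I) (b b' : B), e i b = some b' → wt b' = wt b + α i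
  eps_e_re : ∀ (i : I) (b b' : B), A i i = 2 → e i b = some b' →
    eps i b' = eps i b + ((-1 : ℤ) : WithBot ℤ)
  eps_e_im : ∀ (i : I) (b b' : B), A i i ≠ 2 → e i b = some b' →
    eps i b' = eps i b
  e_iff_f : ∀ (i : I) (b b' : B), e i b = some b' ↔ f i b' = some b
  phi_bot : ∀ (i : I) (b : B), phi i b = ⊥ → e i b = none ∧ f i b = none
  eps_im : ∀ (i : I) (b : B), A i i ≠ 2 → eps i b ≤ 0
  phi_im : ∀ (i : I) (b : B), A i i ≠ 2 → phi i b = ⊥ ∨ 0 ≤ phi i b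

/-- Finite "orthogonal" subsets of the imaginary simple roots, encoded by their
index sets: `F ∈ 𝒫(Π_im)`. -/
def PImSet (A : I → I → ℤ) (F : Finset I) : Prop :=
  (∀ i ∈ F, A i i ≠ 2) ∧ ∀ i ∈ F, ∀ j ∈ F, i ≠ j → A i j = 0

end GKM

namespace GKM

variable {I V : Type*} [AddCommGroup V] [Module ℚ V]

/-- The standing assumptions on a Borcherds–Cartan datum with linearly independent simple
roots. -/
structure IsDatum (A : I → I → ℤ) (α : I → V) (coroot : I → (V →ₗ[ℚ] ℚ)) : Prop where
  linInd : LinearIndependent ℚ α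
  pair : ∀ i j, coroot i (α j) = (A i j : ℚ)
  diag : ∀ i, A i i = 2 ∨ A i i ≤ 0
  off : ∀ i j, i ≠ j → A i j ≤ 0
  zero : ∀ i j, A i j = 0 ↔ A j i = 0

/-- The endomorphism attached to a word in the simple reflections. -/
def wordEnd (α : I → V) (coroot : I → (V →ₗ[ℚ] ℚ)) (l : List I) : Module.End ℚ V :=
  (l.map (srefl α coroot)).prod

/-- A word all of whose letters are real indices. -/
def RealWord (A : I → I → ℤ) (l : List I) : Prop := ∀ m ∈ l, A m m = 2

variable {A : I → I → ℤ} {α : I → V} {coroot : I → (V →ₗ[ℚ] ℚ)}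

lemma srefl_apply (i : I) (x : V) : srefl α coroot i x = x - coroot i x • α i := rfl

lemma crefl_apply (i : I) (h : V →ₗ[ℚ] ℚ) (x : V) :
    crefl α coroot i h x = h x - h (α i) * coroot i x := rfl

@[simp] lemma wordEnd_nil : wordEnd α coroot [] = 1 := rfl

@[simp] lemma wordEnd_cons (i : I) (l : List I) :
    wordEnd α coroot (i :: l) = srefl α coroot i * wordEnd α coroot l := by
  simp [wordEnd]

@[simp] lemma wordEnd_append (l l' : List I) :
    wordEnd α coroot (l ++ l') = wordEnd α coroot l * wordEnd α coroot l' := by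
  simp [wordEnd]

lemma RealWord.append {l l' : List I} (h : RealWord A l) (h' : RealWord A l') :
    RealWord A (l ++ l') := by
  intro m hm
  rcases List.mem_append.1 hm with hm | hm
  exacts [h m hm, h' m hm]

lemma realWord_singleton {i : I} (h : A i i = 2) : RealWord A [i] := by
  simpa [RealWord] using h

lemma RealWord.cons {i : I} {l : List I} (h : A i i = 2) (h' : RealWord A l) :
    RealWord A (i :: l) := by
  simpa [RealWord] using ⟨h, h'⟩

lemma RealWord.reverse {l : List I} (h : RealWord A l) : RealWord A l.reverse :=
  fun m hm => h m (List.mem_reverse.1 hm)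

lemma realWord_alternatingWord {i j : I} (hi : A i i = 2) (hj : A j j = 2) (m : ℕ) :
    RealWord A (CoxeterSystem.alternatingWord i j m) := by
  induction m with
  | zero => simp [CoxeterSystem.alternatingWord, RealWord]
  | succ m ih =>
    rw [CoxeterSystem.alternatingWord_succ']
    refine RealWord.cons ?_ ih
    split_ifs <;> assumption

lemma mem_Qplus_iff {x : V} : x ∈ Qplus α ↔ x ∈ AddSubmonoid.closure (Set.range α) := by
  rw [AddSubmonoid.mem_closure_range_iff]
  simp only [Qplus, Set.mem_ofPred_eq, Nat.cast_smul_eq_nsmul]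

lemma zero_mem_Qplus : (0 : V) ∈ Qplus α := mem_Qplus_iff.2 (zero_mem _)

lemma root_mem_Qplus (i : I) : α i ∈ Qplus α :=
  mem_Qplus_iff.2 (AddSubmonoid.subset_closure ⟨i, rfl⟩)

lemma add_mem_Qplus {x y : V} (hx : x ∈ Qplus α) (hy : y ∈ Qplus α) : x + y ∈ Qplus α :=
  mem_Qplus_iff.2 (add_mem (mem_Qplus_iff.1 hx) (mem_Qplus_iff.1 hy))

lemma smul_mem_Qplus {x : V} (hx : x ∈ Qplus α) {z : ℤ} (hz : 0 ≤ z) :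
    (z : ℚ) • x ∈ Qplus α := by
  lift z to ℕ using hz
  rw [mem_Qplus_iff, Int.cast_natCast, Nat.cast_smul_eq_nsmul]
  exact AddSubmonoid.nsmul_mem _ (mem_Qplus_iff.1 hx) z

namespace IsDatum

lemma srefl_mul_self (D : IsDatum A α coroot) {i : I} (hi : A i i = 2) :
    srefl α coroot i * srefl α coroot i = 1 := by
  ext x
  simp only [Module.End.mul_apply, srefl_apply, map_sub, map_smul, D.pair, hi,
    Module.End.one_apply]
  push_cast
  module

lemma exists_coords (D : IsDatum A α coroot) : ∃ g : V →ₗ[ℚ] (I →₀ ℚ), ∀ i, g (α i) = Finsupp.single i 1 := by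
  obtain ⟨g, hg⟩ := LinearMap.exists_leftInverse_of_injective
    (Finsupp.linearCombination ℚ α) (LinearMap.ker_eq_bot.2 D.linInd)
  refine ⟨g, fun i => ?_⟩
  have := LinearMap.congr_fun hg (Finsupp.single i 1)
  simpa using this

/-- Coefficients on `α i`, `α j` of the image of `α i` under the alternating word of length `m`
ending in `j`, where `a = -a_{ij}` and `b = -a_{ji}`. -/
def altCoef (a b : ℤ) : ℕ → ℤ × ℤ
  | 0 => (1, 0)
  | m + 1 =>
    if Even m then ((altCoef a b m).1, b * (altCoef a b m).1 - (altCoef a b m).2)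
    else (a * (altCoef a b m).2 - (altCoef a b m).1, (altCoef a b m).2)

lemma wordEnd_alternatingWord_root (D : IsDatum A α coroot) {i j : I} (hi : A i i = 2)
    (hj : A j j = 2) (m : ℕ) :
    wordEnd α coroot (CoxeterSystem.alternatingWord i j m) (α i) =
      ((altCoef (-A i j) (-A j i) m).1 : ℚ) • α i +
        ((altCoef (-A i j) (-A j i) m).2 : ℚ) • α j := by
  induction m with
  | zero => simp [CoxeterSystem.alternatingWord, altCoef]
  | succ m ih =>
    rw [CoxeterSystem.alternatingWord_succ', wordEnd_cons, Module.End.mul_apply, ih, altCoef]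
    split_ifs
    · simp only [srefl_apply, map_add, map_smul, D.pair, hj]
      push_cast
      module
    · simp only [srefl_apply, map_add, map_smul, D.pair, hi]
      push_cast
      module

lemma altCoef_nonneg {a b : ℤ} (ha : 0 ≤ a) (hb : 0 ≤ b) (hab : 4 ≤ a * b) (m : ℕ) :
    0 ≤ (altCoef a b m).1 ∧ 0 ≤ (altCoef a b m).2 := by
  suffices h : 0 ≤ (altCoef a b m).1 ∧ 0 ≤ (altCoef a b m).2 ∧
      if Even m then 2 * (altCoef a b m).2 ≤ b * (altCoef a b m).1
      else 2 * (altCoef a b m).1 ≤ a * (altCoef a b m).2 from ⟨h.1, h.2.1⟩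
  induction m with
  | zero => simpa [altCoef] using hb
  | succ m ih =>
    obtain ⟨hp, hq, h⟩ := ih
    set p := (altCoef a b m).1
    set q := (altCoef a b m).2
    by_cases hm : Even m
    · simp only [hm, if_true] at h
      have hm' : ¬ Even (m + 1) := by simpa [Nat.even_add_one] using hm
      simp only [altCoef, hm, hm', if_true, if_false]
      refine ⟨hp, by linarith, ?_⟩
      nlinarith [mul_le_mul_of_nonneg_left h ha, mul_le_mul_of_nonneg_right hab hp]
    · simp only [hm, if_false] at h
      have hm' : Even (m + 1) := by simpa [Nat.even_add_one] using hm
      simp only [altCoef, hm, hm', if_true, if_false]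
      refine ⟨by linarith, hq, ?_⟩
      nlinarith [mul_le_mul_of_nonneg_left h hb, mul_le_mul_of_nonneg_right hab hq]

lemma exists_shorter_of_braid {i j : I} (hi : A i i = 2) (hj : A j j = 2)
    (D : IsDatum A α coroot) {M m : ℕ} (hM : 0 < M) (hm : M ≤ m)
    (hbraid : wordEnd α coroot (CoxeterSystem.alternatingWord i j M) =
      wordEnd α coroot (CoxeterSystem.alternatingWord j i M)) :
    ∃ l, RealWord A l ∧ l.length < m ∧
      wordEnd α coroot (CoxeterSystem.alternatingWord i j m) * srefl α coroot i =
        wordEnd α coroot l := by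
  induction m, hm using Nat.le_induction with
  | base =>
    obtain ⟨M, rfl⟩ := Nat.exists_eq_succ_of_ne_zero hM.ne'
    refine ⟨CoxeterSystem.alternatingWord i j M, realWord_alternatingWord hi hj M, by simp, ?_⟩
    rw [hbraid, Nat.succ_eq_add_one, CoxeterSystem.alternatingWord_succ, List.concat_eq_append,
      wordEnd_append, mul_assoc, wordEnd_cons, wordEnd_nil, mul_one, D.srefl_mul_self hi, mul_one]
  | succ m _ ih =>
    obtain ⟨l, hl, hlm, h⟩ := ih
    refine ⟨(if Even m then j else i) :: l, RealWord.cons (by split_ifs <;> assumption) hl,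
      by simpa using hlm, ?_⟩
    rw [CoxeterSystem.alternatingWord_succ', wordEnd_cons, wordEnd_cons, mul_assoc, h]

lemma braid_aux (D : IsDatum A α coroot) {i j : I} (hi : A i i = 2) (hj : A j j = 2) {a b : ℚ}
    (ha : (A i j : ℚ) = a) (hb : (A j i : ℚ) = b) (x : V) (p q : ℚ) :
    srefl α coroot i (x + p • α i + q • α j) =
        x + (-p - coroot i x - a * q) • α i + q • α j ∧
      srefl α coroot j (x + p • α i + q • α j) =
        x + p • α i + (-q - coroot j x - b * p) • α j := by
  constructor
  · simp only [srefl_apply, map_add, map_smul, D.pair, hi, ha]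
    push_cast
    module
  · simp only [srefl_apply, map_add, map_smul, D.pair, hj, hb]
    push_cast
    module

lemma braid_relation (D : IsDatum A α coroot) {i j : I} (hi : A i i = 2) (hj : A j j = 2) (M : ℕ)
    (h : (A i j = 0 ∧ A j i = 0 ∧ M = 2) ∨ (A i j = -1 ∧ A j i = -1 ∧ M = 3) ∨
      (A i j = -1 ∧ A j i = -2 ∧ M = 4) ∨ (A i j = -2 ∧ A j i = -1 ∧ M = 4) ∨
      (A i j = -1 ∧ A j i = -3 ∧ M = 6) ∨ (A i j = -3 ∧ A j i = -1 ∧ M = 6)) :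
    wordEnd α coroot (CoxeterSystem.alternatingWord i j M) =
      wordEnd α coroot (CoxeterSystem.alternatingWord j i M) := by
  ext x
  have hx : x = x + (0 : ℚ) • α i + (0 : ℚ) • α j := by simp
  obtain ⟨ha, hb, rfl⟩ | ⟨ha, hb, rfl⟩ | ⟨ha, hb, rfl⟩ | ⟨ha, hb, rfl⟩ | ⟨ha, hb, rfl⟩ |
    ⟨ha, hb, rfl⟩ := h
  all_goals
    have key := D.braid_aux hi hj (congrArg Int.cast ha) (congrArg Int.cast hb) x
    rw [hx]
    simp only [CoxeterSystem.alternatingWord, List.concat_eq_append, List.nil_append,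
      List.cons_append, wordEnd_cons, wordEnd_nil, Module.End.mul_apply, Module.End.one_apply,
      (key _ _).1, (key _ _).2]
    push_cast
    module

lemma rank_two (D : IsDatum A α coroot) {i j : I} (hi : A i i = 2) (hj : A j j = 2)
    (hij : i ≠ j) (m : ℕ) :
    (0 ≤ (altCoef (-A i j) (-A j i) m).1 ∧ 0 ≤ (altCoef (-A i j) (-A j i) m).2) ∨
      ∃ l, RealWord A l ∧ l.length < m ∧
        wordEnd α coroot (CoxeterSystem.alternatingWord i j m) * srefl α coroot i =
          wordEnd α coroot l := by
  have ha := D.off i j hij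
  have hb := D.off j i hij.symm
  have h0 := D.zero i j
  by_cases hab : 4 ≤ -A i j * -A j i
  · exact Or.inl (altCoef_nonneg (by omega) (by omega) hab m)
  have hcases : ∃ M, (A i j = 0 ∧ A j i = 0 ∧ M = 2) ∨ (A i j = -1 ∧ A j i = -1 ∧ M = 3) ∨
      (A i j = -1 ∧ A j i = -2 ∧ M = 4) ∨ (A i j = -2 ∧ A j i = -1 ∧ M = 4) ∨
      (A i j = -1 ∧ A j i = -3 ∧ M = 6) ∨ (A i j = -3 ∧ A j i = -1 ∧ M = 6) := by
    by_cases hz : A i j = 0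
    · exact ⟨2, Or.inl ⟨hz, h0.1 hz, rfl⟩⟩
    have hz' : A j i ≠ 0 := fun h => hz (h0.2 h)
    have h1 : -3 ≤ A i j := by nlinarith [show A j i ≤ -1 by omega]
    have h2 : -3 ≤ A j i := by nlinarith [show A i j ≤ -1 by omega]
    generalize A i j = a at *
    generalize A j i = b at *
    interval_cases a <;> interval_cases b <;> simp_all
  obtain ⟨M, hM⟩ := hcases
  have hbraid := D.braid_relation hi hj M hM
  by_cases hm : M ≤ m
  · exact Or.inr (exists_shorter_of_braid hi hj D (by omega) hm hbraid)
  · left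
    obtain ⟨ha, hb, rfl⟩ | ⟨ha, hb, rfl⟩ | ⟨ha, hb, rfl⟩ | ⟨ha, hb, rfl⟩ | ⟨ha, hb, rfl⟩ |
      ⟨ha, hb, rfl⟩ := hM
    all_goals
      rw [ha, hb]
      push Not at hm
      interval_cases m <;> decide
lemma lenW_le {l : List I} (hl : RealWord A l) :
    lenW A α coroot (wordEnd α coroot l) ≤ l.length :=
  Nat.sInf_le ⟨l, hl, rfl, rfl⟩

lemma exists_reduced {l : List I} (hl : RealWord A l) :
    ∃ l', RealWord A l' ∧ wordEnd α coroot l' = wordEnd α coroot l ∧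
      l'.length = lenW A α coroot (wordEnd α coroot l) := by
  have hne : {n | ∃ l' : List I, (∀ m ∈ l', A m m = 2) ∧ l'.length = n ∧
      (l'.map (srefl α coroot)).prod = wordEnd α coroot l}.Nonempty :=
    ⟨l.length, l, hl, rfl, rfl⟩
  obtain ⟨l', h1, h2, h3⟩ := Nat.sInf_mem hne
  exact ⟨l', h1, h3, h2⟩

lemma lenW_mul_le {l : List I} (hl : RealWord A l) {l' : List I} (hl' : RealWord A l') :
    lenW A α coroot (wordEnd α coroot l * wordEnd α coroot l') ≤
      lenW A α coroot (wordEnd α coroot l) + l'.length := by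
  obtain ⟨r, hr, hrl, hlen⟩ := exists_reduced (α := α) (coroot := coroot) hl
  rw [← hlen, ← hrl, ← wordEnd_append, ← List.length_append]
  exact lenW_le (hr.append hl')

lemma lenW_mul_srefl_le {l : List I} (hl : RealWord A l) {i : I} (hi : A i i = 2) :
    lenW A α coroot (wordEnd α coroot l * srefl α coroot i) ≤
      lenW A α coroot (wordEnd α coroot l) + 1 := by
  simpa using lenW_mul_le (α := α) (coroot := coroot) hl (realWord_singleton hi)

/-- Splitting off a maximal alternating suffix from a word ending in `j`. -/
lemma exists_alternating_suffix (D : IsDatum A α coroot) {n : ℕ} : ∀ {i j : I}, A i i = 2 →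
    A j j = 2 → ∀ {l : List I}, RealWord A l → lenW A α coroot (wordEnd α coroot l) = n →
    lenW A α coroot (wordEnd α coroot l * srefl α coroot j) < n →
    ∃ l' m, RealWord A l' ∧ 0 < m ∧ lenW A α coroot (wordEnd α coroot l') + m = n ∧
      wordEnd α coroot l =
        wordEnd α coroot l' * wordEnd α coroot (CoxeterSystem.alternatingWord i j m) ∧
      lenW A α coroot (wordEnd α coroot l') ≤
        lenW A α coroot (wordEnd α coroot l' * srefl α coroot i) ∧
      lenW A α coroot (wordEnd α coroot l') ≤
        lenW A α coroot (wordEnd α coroot l' * srefl α coroot j) := by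
  induction n with
  | zero => intros; omega
  | succ n ih =>
    intro i j hi hj l hl hn hlt
    have hl1 : RealWord A (l ++ [j]) := hl.append (realWord_singleton hj)
    have e1 : wordEnd α coroot (l ++ [j]) = wordEnd α coroot l * srefl α coroot j := by simp
    have e2 : wordEnd α coroot (l ++ [j]) * srefl α coroot j = wordEnd α coroot l := by
      rw [e1, mul_assoc, D.srefl_mul_self hj, mul_one]
    have hle := lenW_mul_srefl_le (α := α) (coroot := coroot) hl1 hj
    rw [e2, hn] at hle
    rw [← e1] at hlt
    have hn1 : lenW A α coroot (wordEnd α coroot (l ++ [j])) = n := by omega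
    by_cases hc : lenW A α coroot (wordEnd α coroot (l ++ [j]) * srefl α coroot i) < n
    · obtain ⟨l', m, hl', hm, hlen, heq, hmi, hmj⟩ := ih hj hi hl1 hn1 hc
      refine ⟨l', m + 1, hl', by omega, by omega, ?_, hmj, hmi⟩
      rw [← e2, heq, CoxeterSystem.alternatingWord_succ, List.concat_eq_append, wordEnd_append,
        wordEnd_cons, wordEnd_nil, mul_one, mul_assoc]
    · refine ⟨l ++ [j], 1, hl1, one_pos, by omega, ?_, by omega, ?_⟩
      · rw [← e2]
        simp [CoxeterSystem.alternatingWord]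
      · rw [e2, hn]
        omega

lemma exists_last_letter (D : IsDatum A α coroot) {l : List I} (hl : RealWord A l)
    (h : lenW A α coroot (wordEnd α coroot l) ≠ 0) :
    ∃ l' j, RealWord A l' ∧ A j j = 2 ∧ wordEnd α coroot l = wordEnd α coroot (l' ++ [j]) ∧
      lenW A α coroot (wordEnd α coroot l') < lenW A α coroot (wordEnd α coroot l) ∧
      wordEnd α coroot l * srefl α coroot j = wordEnd α coroot l' := by
  obtain ⟨r, hr, hrl, hlen⟩ := exists_reduced (α := α) (coroot := coroot) hl
  rcases List.eq_nil_or_concat r with rfl | ⟨l', j, rfl⟩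
  · simp at hlen
    omega
  · rw [List.concat_eq_append] at *
    have hj : A j j = 2 := hr j (by simp)
    have hl' : RealWord A l' := fun m hm => hr m (by simp [hm])
    refine ⟨l', j, hl', hj, hrl.symm, ?_, ?_⟩
    · have := lenW_le (α := α) (coroot := coroot) hl'
      rw [List.length_append, List.length_singleton] at hlen
      omega
    · rw [← hrl, wordEnd_append, wordEnd_cons, wordEnd_nil, mul_one, mul_assoc,
        D.srefl_mul_self hj, mul_one]

theorem wordEnd_root_mem_Qplus (D : IsDatum A α coroot) : ∀ (n : ℕ) {l : List I},
    RealWord A l → lenW A α coroot (wordEnd α coroot l) = n → ∀ {i : I}, A i i = 2 →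
    n ≤ lenW A α coroot (wordEnd α coroot l * srefl α coroot i) →
    wordEnd α coroot l (α i) ∈ Qplus α := by
  intro n
  induction n using Nat.strong_induction_on with
  | _ n ih =>
    intro l hl hn i hi hle
    rcases Nat.eq_zero_or_pos n with rfl | hpos
    · obtain ⟨r, hr, hrl, hlen⟩ := exists_reduced (α := α) (coroot := coroot) hl
      rw [hn, List.length_eq_zero_iff] at hlen
      rw [← hrl, hlen]
      exact root_mem_Qplus i
    obtain ⟨l₀, j, hl₀, hj, -, hlt, hmul⟩ := D.exists_last_letter hl (by omega)
    have hij : i ≠ j := by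
      rintro rfl
      rw [hmul] at hle
      omega
    obtain ⟨l', m, hl', hm, hlen, heq, hmi, hmj⟩ :=
      D.exists_alternating_suffix hi hj hl hn (by rw [hmul]; omega)
    rcases D.rank_two hi hj hij m with ⟨hp, hq⟩ | ⟨r, hr, hrm, hreq⟩
    · rw [heq, Module.End.mul_apply, D.wordEnd_alternatingWord_root hi hj, map_add, map_smul,
        map_smul]
      exact add_mem_Qplus (smul_mem_Qplus (ih _ (by omega) hl' rfl hi hmi) hp)
        (smul_mem_Qplus (ih _ (by omega) hl' rfl hj hmj) hq)
    · rw [heq, mul_assoc, hreq] at hle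
      have := lenW_mul_le (α := α) (coroot := coroot) hl' hr
      omega

lemma wordEnd_srefl_root (D : IsDatum A α coroot) {i : I} (hi : A i i = 2)
    (w : Module.End ℚ V) : (w * srefl α coroot i) (α i) = -w (α i) := by
  rw [Module.End.mul_apply, srefl_apply, D.pair, hi, ← map_neg]
  congr 1
  push_cast
  module

lemma neg_wordEnd_root_mem_Qplus (D : IsDatum A α coroot) {l : List I} (hl : RealWord A l)
    {i : I} (hi : A i i = 2) (h : lenW A α coroot (wordEnd α coroot l * srefl α coroot i) ≤
      lenW A α coroot (wordEnd α coroot l)) :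
    -wordEnd α coroot l (α i) ∈ Qplus α := by
  have e1 : wordEnd α coroot (l ++ [i]) = wordEnd α coroot l * srefl α coroot i := by simp
  rw [← D.wordEnd_srefl_root hi, ← e1]
  refine D.wordEnd_root_mem_Qplus _ (hl.append (realWord_singleton hi)) rfl hi ?_
  rw [e1, mul_assoc, D.srefl_mul_self hi, mul_one]
  exact h

theorem wordEnd_root_pos_or_neg (D : IsDatum A α coroot) {l : List I} (hl : RealWord A l)
    {i : I} (hi : A i i = 2) :
    wordEnd α coroot l (α i) ∈ Qplus α ∨ -wordEnd α coroot l (α i) ∈ Qplus α := by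
  rcases le_total (lenW A α coroot (wordEnd α coroot l))
    (lenW A α coroot (wordEnd α coroot l * srefl α coroot i)) with h | h
  · exact Or.inl (D.wordEnd_root_mem_Qplus _ hl rfl hi h)
  · exact Or.inr (D.neg_wordEnd_root_mem_Qplus hl hi h)

/-- The Weyl group moves antidominant integral vectors up in the root order. -/
lemma wordEnd_sub_mem_Qplus (D : IsDatum A α coroot) {x : V}
    (hx : ∀ j, A j j = 2 → ∃ z : ℤ, 0 ≤ z ∧ coroot j x = -(z : ℚ)) {l : List I}
    (hl : RealWord A l) : wordEnd α coroot l x - x ∈ Qplus α := by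
  induction hn : lenW A α coroot (wordEnd α coroot l) using Nat.strong_induction_on
    generalizing l with
  | _ n ih =>
    subst hn
    by_cases h0 : lenW A α coroot (wordEnd α coroot l) = 0
    · obtain ⟨r, hr, hrl, hlen⟩ := exists_reduced (α := α) (coroot := coroot) hl
      rw [h0, List.length_eq_zero_iff] at hlen
      rw [← hrl, hlen]
      simpa using zero_mem_Qplus
    · obtain ⟨l', j, hl', hj, heq, hlt, -⟩ := D.exists_last_letter hl h0
      obtain ⟨z, hz, hjx⟩ := hx j hj
      have hpos : wordEnd α coroot l' (α j) ∈ Qplus α := by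
        refine D.wordEnd_root_mem_Qplus _ hl' rfl hj ?_
        rw [heq] at hlt
        simpa using hlt.le
      have : wordEnd α coroot l x - x =
          (wordEnd α coroot l' x - x) + (z : ℚ) • wordEnd α coroot l' (α j) := by
        rw [heq]
        simp only [wordEnd_append, wordEnd_cons, wordEnd_nil, mul_one, Module.End.mul_apply,
          srefl_apply, map_sub, map_smul, hjx]
        module
      rw [this]
      exact add_mem_Qplus (ih _ hlt hl' rfl) (smul_mem_Qplus hpos hz)

lemma wordEnd_im_root_mem_Qplus (D : IsDatum A α coroot) {k : I} (hk : A k k ≠ 2)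
    {l : List I} (hl : RealWord A l) : wordEnd α coroot l (α k) ∈ Qplus α := by
  have h := D.wordEnd_sub_mem_Qplus (x := α k) (fun j hj => ⟨-A j k,
    neg_nonneg.2 (D.off j k (by rintro rfl; exact hk hj)), by rw [D.pair]; push_cast; ring⟩) hl
  simpa using add_mem_Qplus h (root_mem_Qplus k)

lemma exists_nat_coord {g : V →ₗ[ℚ] (I →₀ ℚ)} (hg : ∀ i, g (α i) = Finsupp.single i 1) {x : V}
    (hx : x ∈ Qplus α) (i : I) : ∃ n : ℕ, g x i = n := by
  obtain ⟨c, rfl⟩ := hx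
  refine ⟨c i, ?_⟩
  rw [Finsupp.sum, map_sum, Finsupp.finsetSum_apply]
  simp only [map_smul, hg, Finsupp.smul_single, smul_eq_mul, mul_one]
  rw [Finset.sum_eq_single i]
  · simp
  · intro j _ hj
    simp [hj]
  · intro hi
    simp [Finsupp.notMem_support_iff.1 hi]

lemma eq_linearCombination_of_mem_Qplus {g : V →ₗ[ℚ] (I →₀ ℚ)}
    (hg : ∀ i, g (α i) = Finsupp.single i 1) {x : V} (hx : x ∈ Qplus α) :
    x = Finsupp.linearCombination ℚ α (g x) := by
  obtain ⟨c, rfl⟩ := hx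
  simp [Finsupp.sum, map_sum, hg]

lemma eq_smul_root_of_mem_Qplus {g : V →ₗ[ℚ] (I →₀ ℚ)}
    (hg : ∀ i, g (α i) = Finsupp.single i 1) {x : V} (hx : x ∈ Qplus α) {i : I}
    (h : ∀ j, j ≠ i → g x j = 0) : x = g x i • α i := by
  have : g x = Finsupp.single i (g x i) := by
    ext j
    by_cases hj : j = i
    · simp [hj]
    · simp [h j hj, Ne.symm hj]
  conv_lhs => rw [eq_linearCombination_of_mem_Qplus hg hx, this, Finsupp.linearCombination_single]

lemma eq_zero_of_mem_Qplus_neg_mem (D : IsDatum A α coroot) {x : V} (hx : x ∈ Qplus α)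
    (hx' : -x ∈ Qplus α) : x = 0 := by
  obtain ⟨g, hg⟩ := D.exists_coords
  have h0 : g x = 0 := by
    ext i
    obtain ⟨n, hn⟩ := exists_nat_coord hg hx i
    obtain ⟨m, hm⟩ := exists_nat_coord hg hx' i
    rw [map_neg, Finsupp.neg_apply] at hm
    have : (0 : ℚ) ≤ n := n.cast_nonneg
    have : (0 : ℚ) ≤ m := m.cast_nonneg
    simp only [Finsupp.coe_zero, Pi.zero_apply]
    linarith
  rw [eq_linearCombination_of_mem_Qplus hg hx, h0, map_zero]

lemma wordEnd_mul_reverse (D : IsDatum A α coroot) {l : List I} (hl : RealWord A l) :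
    wordEnd α coroot l * wordEnd α coroot l.reverse = 1 := by
  induction l with
  | nil => simp
  | cons i l ih =>
    rw [List.reverse_cons, wordEnd_append, wordEnd_cons, wordEnd_cons, wordEnd_nil, mul_one,
      mul_assoc, ← mul_assoc (wordEnd α coroot l), ih fun m hm => hl m (by simp [hm]), one_mul,
      D.srefl_mul_self (hl i (by simp))]

lemma wordEnd_reverse_mul (D : IsDatum A α coroot) {l : List I} (hl : RealWord A l) :
    wordEnd α coroot l.reverse * wordEnd α coroot l = 1 := by
  simpa using D.wordEnd_mul_reverse hl.reverse

lemma crefl_word_apply (l : List I) (h : V →ₗ[ℚ] ℚ) (x : V) :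
    (l.map (crefl α coroot)).prod h x = h (wordEnd α coroot l.reverse x) := by
  induction l generalizing x with
  | nil => simp
  | cons i l ih =>
    rw [List.map_cons, List.prod_cons, Module.End.mul_apply, crefl_apply, ih, ih,
      List.reverse_cons, wordEnd_append, wordEnd_cons, wordEnd_nil, mul_one,
      Module.End.mul_apply, srefl_apply, map_sub, map_smul, map_sub, map_smul, smul_eq_mul,
      mul_comm]

lemma root_ne_zero (D : IsDatum A α coroot) (i : I) : α i ≠ 0 := D.linInd.ne_zero i

lemma wordEnd_eq_one (D : IsDatum A α coroot) {l : List I} (hl : RealWord A l)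
    (h : ∀ j, A j j = 2 → wordEnd α coroot l (α j) ∈ Qplus α) : wordEnd α coroot l = 1 := by
  by_cases h0 : lenW A α coroot (wordEnd α coroot l) = 0
  · obtain ⟨r, hr, hrl, hlen⟩ := exists_reduced (α := α) (coroot := coroot) hl
    rw [h0, List.length_eq_zero_iff] at hlen
    rw [← hrl, hlen, wordEnd_nil]
  · obtain ⟨l', j, hl', hj, heq, hlt, hmul⟩ := D.exists_last_letter hl h0
    have hneg := D.neg_wordEnd_root_mem_Qplus hl hj (by rw [hmul]; exact hlt.le)
    have hz := D.eq_zero_of_mem_Qplus_neg_mem (h j hj) hneg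
    refine absurd ?_ (D.root_ne_zero j)
    have := LinearMap.congr_fun (D.wordEnd_reverse_mul hl) (α j)
    rwa [Module.End.mul_apply, hz, map_zero, Module.End.one_apply, eq_comm] at this

/-- A real coroot is determined by its root, here for simple roots. -/
lemma coroot_eq_of_root_eq (D : IsDatum A α coroot) {l : List I} (hl : RealWord A l) {k i : I}
    (hk : A k k = 2) (hi : A i i = 2) (h : wordEnd α coroot l (α k) = α i) :
    (l.map (crefl α coroot)).prod (coroot k) = coroot i := by
  set βv := (l.map (crefl α coroot)).prod (coroot k) with hβv
  have hβi : βv (α i) = 2 := by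
    rw [hβv, crefl_word_apply, ← h, ← Module.End.mul_apply, D.wordEnd_reverse_mul hl,
      Module.End.one_apply, D.pair, hk]
    norm_num
  set u := l ++ [k] ++ l.reverse ++ [i] with hu
  have hur : RealWord A u :=
    ((hl.append (realWord_singleton hk)).append hl.reverse).append (realWord_singleton hi)
  have hux : ∀ x, wordEnd α coroot u x = x + (coroot i x - βv x) • α i := by
    intro x
    have hrefl : ∀ y, wordEnd α coroot (l ++ [k] ++ l.reverse) y = y - βv y • α i := by
      intro y
      have hy := LinearMap.congr_fun (D.wordEnd_mul_reverse hl) y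
      rw [Module.End.mul_apply, Module.End.one_apply] at hy
      rw [wordEnd_append, wordEnd_append, wordEnd_cons, wordEnd_nil, mul_one,
        Module.End.mul_apply, Module.End.mul_apply, srefl_apply, map_sub, map_smul, hy, h,
        hβv, crefl_word_apply]
    rw [hu, wordEnd_append, Module.End.mul_apply, hrefl, wordEnd_cons, wordEnd_nil, mul_one,
      srefl_apply, map_sub, map_smul, hβi, smul_eq_mul]
    module
  obtain ⟨g, hg⟩ := D.exists_coords
  have hone : wordEnd α coroot u = 1 := by
    refine D.wordEnd_eq_one hur fun j hj => ?_
    rcases eq_or_ne j i with rfl | hji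
    · rw [hux, hβi, D.pair, hi]
      simpa using root_mem_Qplus j
    · refine (D.wordEnd_root_pos_or_neg hur hj).resolve_right fun hneg => ?_
      obtain ⟨n, hn⟩ := exists_nat_coord hg hneg j
      rw [hux, map_neg, map_add, map_smul, hg, hg] at hn
      have : (0 : ℚ) ≤ n := n.cast_nonneg
      simp [hji] at hn
      linarith
  ext x
  have := hux x
  rw [hone, Module.End.one_apply, left_eq_add, smul_eq_zero] at this
  have := this.resolve_right (D.root_ne_zero i)
  linarith

/-- A positive real root which becomes non-positive under `r_i` equals `α_i`. -/
lemma wordEnd_root_eq_of_notMem (D : IsDatum A α coroot) {l : List I} (hl : RealWord A l)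
    {k i : I} (hk : A k k = 2) (hi : A i i = 2) (hpos : wordEnd α coroot l (α k) ∈ Qplus α)
    (hnot : wordEnd α coroot (i :: l) (α k) ∉ Qplus α) : wordEnd α coroot l (α k) = α i := by
  obtain ⟨g, hg⟩ := D.exists_coords
  have hneg := (D.wordEnd_root_pos_or_neg (RealWord.cons hi hl) hk).resolve_left hnot
  rw [wordEnd_cons, Module.End.mul_apply, srefl_apply] at hneg
  have hmul : wordEnd α coroot l (α k) = g (wordEnd α coroot l (α k)) i • α i := by
    refine eq_smul_root_of_mem_Qplus hg hpos fun j hj => ?_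
    obtain ⟨n, hn⟩ := exists_nat_coord hg hpos j
    obtain ⟨m, hm⟩ := exists_nat_coord hg hneg j
    rw [map_neg, map_sub, map_smul, hg] at hm
    have : (0 : ℚ) ≤ n := n.cast_nonneg
    have : (0 : ℚ) ≤ m := m.cast_nonneg
    simp [hj.symm] at hm
    linarith
  obtain ⟨n, hn⟩ := exists_nat_coord hg hpos i
  rw [hn] at hmul
  have hinv : α k = (n : ℚ) • wordEnd α coroot l.reverse (α i) := by
    rw [← map_smul, ← hmul, ← Module.End.mul_apply, D.wordEnd_reverse_mul hl,
      Module.End.one_apply]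
  have hz : ∃ z : ℤ, g (wordEnd α coroot l.reverse (α i)) k = z := by
    rcases D.wordEnd_root_pos_or_neg hl.reverse hi with h | h
    · obtain ⟨m, hm⟩ := exists_nat_coord hg h k
      exact ⟨m, by simpa using hm⟩
    · obtain ⟨m, hm⟩ := exists_nat_coord hg h k
      rw [map_neg, Finsupp.neg_apply] at hm
      exact ⟨-m, by push_cast; linarith⟩
  obtain ⟨z, hz⟩ := hz
  have h1 := congrArg (fun x => g x k) hinv
  simp only [hg, map_smul, Finsupp.single_eq_same, Finsupp.smul_apply, hz, smul_eq_mul] at h1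
  have h2 : (1 : ℤ) = n * z := by exact_mod_cast h1
  have h3 : (n : ℤ) = 1 := Int.eq_one_of_dvd_one (by positivity) ⟨z, h2⟩
  have h4 : n = 1 := by exact_mod_cast h3
  rw [hmul, h4]
  simp

lemma srefl_mem_Torbit {lam x : V} (hx : x ∈ Torbit α coroot lam) (i : I) :
    srefl α coroot i x ∈ Torbit α coroot lam := by
  obtain ⟨τ, hτ, rfl⟩ := hx
  exact ⟨srefl α coroot i * τ, mul_mem (Submonoid.subset_closure ⟨i, rfl⟩) hτ, rfl⟩

lemma simple_pair (i : I) : IsWRootPair A α coroot (α i) (coroot i) :=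
  ⟨[], i, by simp, by simp, by simp⟩

/-- If a covering relation `μ = r_β ν` changes the sign of a real simple coroot `α_i^∨`, then it
is given by the reflection `r_i`. -/
lemma cover_sign_change (D : IsDatum A α coroot) {lam μ ν β : V} {βv : V →ₗ[ℚ] ℚ} {l : List I}
    {k i : I} (hi : A i i = 2) (hpres : IsWRootPres A α coroot l k β βv) (hβ : β ∈ Qplus α)
    (hpos : 0 < βv ν) (hμν : μ = ν - βv ν • β) (hμ : μ ∈ Torbit α coroot lam)
    (hν : ν ∈ Torbit α coroot lam) (hdist : distEq A α coroot lam μ ν 1)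
    (hμi : coroot i μ < 0) (hνi : 0 < coroot i ν) : A k k = 2 ∧ βv = coroot i := by
  obtain ⟨hl, hβl, hβvl⟩ := hpres
  change β = wordEnd α coroot l (α k) at hβl
  have hnot : wordEnd α coroot (i :: l) (α k) ∉ Qplus α := by
    intro hmem
    rw [wordEnd_cons, Module.End.mul_apply, ← hβl] at hmem
    have hinv : ∀ x, srefl α coroot i (srefl α coroot i x) = x := fun x =>
      LinearMap.congr_fun (D.srefl_mul_self hi) x
    have hcr : ∀ x, crefl α coroot i βv (srefl α coroot i x) = βv x := fun x => by
      conv_rhs => rw [← hinv x]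
      rw [crefl_apply, srefl_apply i (srefl α coroot i x), map_sub, map_smul, smul_eq_mul,
        mul_comm]
    have hneg : ∀ x, coroot i (srefl α coroot i x) = -coroot i x := fun x => by
      rw [srefl_apply, map_sub, map_smul, D.pair, hi, smul_eq_mul]
      push_cast
      ring
    have hchain : IsChain A α coroot lam μ ν 3
        (fun | 0 => μ | 1 => srefl α coroot i μ | 2 => srefl α coroot i ν | _ => ν)
        (fun | 0 => α i | 1 => srefl α coroot i β | _ => α i)
        (fun | 0 => coroot i | 1 => crefl α coroot i βv | _ => coroot i) := by
      refine ⟨rfl, rfl, fun n hn => ?_, fun n hn => ?_⟩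
      · interval_cases n
        exacts [hμ, srefl_mem_Torbit hμ i, srefl_mem_Torbit hν i, hν]
      · interval_cases n
        · refine ⟨simple_pair i, root_mem_Qplus i, ?_, ?_⟩
          · change 0 < coroot i (srefl α coroot i μ)
            rw [hneg]
            linarith
          · exact (hinv μ).symm
        · refine ⟨⟨i :: l, k, RealWord.cons hi hl, ?_, ?_⟩, hmem, ?_, ?_⟩
          · change srefl α coroot i β = wordEnd α coroot (i :: l) (α k)
            rw [wordEnd_cons, Module.End.mul_apply, ← hβl]
          · change crefl α coroot i βv = ((i :: l).map (crefl α coroot)).prod (coroot k)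
            rw [List.map_cons, List.prod_cons, Module.End.mul_apply, ← hβvl]
          · change 0 < crefl α coroot i βv (srefl α coroot i ν)
            rwa [hcr]
          · change srefl α coroot i μ = srefl α coroot i ν -
              crefl α coroot i βv (srefl α coroot i ν) • srefl α coroot i β
            rw [hcr, hμν, map_sub, map_smul]
        · exact ⟨simple_pair i, root_mem_Qplus i, hνi, rfl⟩
    have := hdist.2 _ _ _ _ hchain
    omega
  have hk : A k k = 2 := by
    by_contra hk
    exact hnot (D.wordEnd_im_root_mem_Qplus hk (RealWord.cons hi hl))
  refine ⟨hk, hβvl.trans (D.coroot_eq_of_root_eq hl hk hi ?_)⟩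
  exact D.wordEnd_root_eq_of_notMem hl hk hi (hβl ▸ hβ) hnot

lemma coroot_root_int (D : IsDatum A α coroot) {x : V} (hx : x ∈ Qplus α) (i : I) :
    ∃ n : ℤ, coroot i x = n := by
  obtain ⟨c, rfl⟩ := hx
  refine ⟨c.sum fun j n => n * A i j, ?_⟩
  simp [Finsupp.sum, D.pair]

lemma coroot_Torbit_int (D : IsDatum A α coroot) {lam : V} (hlam : lam ∈ Pplus coroot) {x : V}
    (hx : x ∈ Torbit α coroot lam) (i : I) : ∃ n : ℤ, coroot i x = n := by
  obtain ⟨τ, hτ, rfl⟩ := hx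
  suffices h : ∀ y : V, (∀ i, ∃ n : ℤ, coroot i y = n) → ∀ i, ∃ n : ℤ, coroot i (τ y) = n from
    h lam hlam.1 i
  induction hτ using Submonoid.closure_induction with
  | mem τ hτ =>
    obtain ⟨j, rfl⟩ := hτ
    intro y hy i
    obtain ⟨n, hn⟩ := hy i
    obtain ⟨m, hm⟩ := hy j
    exact ⟨n - m * A i j, by rw [srefl_apply, map_sub, map_smul, hn, hm, D.pair]; simp⟩
  | one => exact fun y hy => hy
  | mul σ τ _ _ hσ hτ => exact fun y hy => hσ _ (hτ y hy)

/-- Imaginary simple coroots are nonnegative on the orbit of a dominant weight. -/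
lemma coroot_Torbit_nonneg (D : IsDatum A α coroot) {lam : V} (hlam : lam ∈ Pplus coroot) {x : V}
    (hx : x ∈ Torbit α coroot lam) {i : I} (hi : A i i ≠ 2) : 0 ≤ coroot i x := by
  have hle : ∀ {y : V} {i : I}, A i i ≠ 2 → lam - y ∈ Qplus α → 0 ≤ coroot i y := by
    rintro y i hi ⟨c, hc⟩
    have h1 : coroot i (lam - y) ≤ 0 := by
      rw [hc, Finsupp.sum, map_sum]
      refine Finset.sum_nonpos fun j _ => ?_
      rw [map_smul, D.pair, smul_eq_mul]
      refine mul_nonpos_of_nonneg_of_nonpos (Nat.cast_nonneg _) ?_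
      rcases eq_or_ne i j with rfl | hij
      · exact_mod_cast (D.diag i).resolve_left hi
      · exact_mod_cast D.off i j hij
    have h2 := hlam.2 i
    rw [map_sub] at h1
    linarith
  obtain ⟨τ, hτ, rfl⟩ := hx
  suffices h : ∀ y : V, (∀ i, ∃ n : ℤ, coroot i y = n) →
      (∀ l, RealWord A l → lam - wordEnd α coroot l y ∈ Qplus α) →
      (∀ i, ∃ n : ℤ, coroot i (τ y) = n) ∧
      (∀ l, RealWord A l → lam - wordEnd α coroot l (τ y) ∈ Qplus α) by
    refine hle hi ((h lam hlam.1 fun l hl => ?_).2 [] (by simp [RealWord]))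
    have := D.wordEnd_sub_mem_Qplus (x := -lam) (fun j _ => ?_) hl
    · rw [map_neg] at this
      convert this using 1
      abel
    · obtain ⟨n, hn⟩ := hlam.1 j
      have := hlam.2 j
      rw [hn] at this
      exact ⟨n, by exact_mod_cast this, by rw [map_neg, hn]⟩
  clear hi i
  induction hτ using Submonoid.closure_induction with
  | mem τ hτ =>
    obtain ⟨j, rfl⟩ := hτ
    intro y hy hl
    refine ⟨fun i => ?_, fun l hlr => ?_⟩
    · obtain ⟨n, hn⟩ := hy i
      obtain ⟨m, hm⟩ := hy j
      exact ⟨n - m * A i j, by rw [srefl_apply, map_sub, map_smul, hn, hm, D.pair]; simp⟩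
    · by_cases hj : A j j = 2
      · simpa using hl (l ++ [j]) (hlr.append (realWord_singleton hj))
      · have h0 : 0 ≤ coroot j y := hle hj (hl [] (by simp [RealWord]))
        obtain ⟨m, hm⟩ := hy j
        rw [hm] at h0
        have : lam - wordEnd α coroot l (srefl α coroot j y) =
            (lam - wordEnd α coroot l y) + (m : ℚ) • wordEnd α coroot l (α j) := by
          rw [srefl_apply, map_sub, map_smul, hm]
          abel
        rw [this]
        exact add_mem_Qplus (hl l hlr)
          (smul_mem_Qplus (D.wordEnd_im_root_mem_Qplus hj hlr) (by exact_mod_cast h0))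
  | one => exact fun y hy hl => ⟨hy, hl⟩
  | mul σ τ _ _ hσ hτ =>
    intro y hy hl
    obtain ⟨h1, h2⟩ := hτ y hy hl
    exact hσ _ h1 h2

/-- The values `a α_i^∨(ν_k)` along an `a`-chain all agree modulo `ℤ`. -/
lemma achain_congr (D : IsDatum A α coroot) {lam μ ν : V} {a : ℚ} {s : ℕ} {c β : ℕ → V}
    {βv : ℕ → (V →ₗ[ℚ] ℚ)} {ks : ℕ → I} (h : IsAChain A α coroot lam a μ ν s c β βv ks) (i : I)
    {k : ℕ} (hk : k ≤ s) : ∃ n : ℤ, a * coroot i (c k) = a * coroot i μ + n := by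
  obtain ⟨-, ⟨h0, -, -, hstep⟩, hcond⟩ := h
  induction k with
  | zero => exact ⟨0, by simp [h0]⟩
  | succ k ih =>
    obtain ⟨n, hn⟩ := ih (by omega)
    obtain ⟨-, hβ, -, hc⟩ := hstep k hk
    obtain ⟨-, -, hre, him⟩ := hcond k hk
    obtain ⟨z, hz⟩ := D.coroot_root_int hβ i
    have hm : ∃ m : ℤ, a * βv k (c (k + 1)) = m := by
      by_cases hA : A (ks k) (ks k) = 2
      · obtain ⟨m, -, hm⟩ := hre hA
        exact ⟨m, by simpa using hm⟩
      · exact ⟨1, by simpa using him hA⟩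
    obtain ⟨m, hm⟩ := hm
    refine ⟨n + m * z, ?_⟩
    rw [hc, map_sub, map_smul, hz, smul_eq_mul] at hn
    push_cast
    rw [← hm]
    linarith

lemma hasAChain_congr (D : IsDatum A α coroot) {lam μ ν : V} {a : ℚ}
    (h : HasAChain A α coroot lam a μ ν) (i : I) :
    ∃ n : ℤ, a * coroot i ν = a * coroot i μ + n := by
  obtain ⟨s, c, β, βv, ks, h⟩ := h
  obtain ⟨n, hn⟩ := D.achain_congr h i le_rfl
  exact ⟨n, by rwa [h.2.1.2.1] at hn⟩

/-- If a real simple coroot changes sign along an `a`-chain, its values times `a` are integers. -/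
lemma hasAChain_int (D : IsDatum A α coroot) {lam μ ν : V} {a : ℚ}
    (h : HasAChain A α coroot lam a μ ν) {i : I} (hi : A i i = 2) (hμ : coroot i μ ≤ 0)
    (hν : 0 ≤ coroot i ν) : ∃ n : ℤ, a * coroot i μ = n := by
  obtain ⟨s, c, β, βv, ks, h⟩ := h
  suffices hex : ∃ k ≤ s, ∃ n : ℤ, a * coroot i (c k) = n by
    obtain ⟨k, hk, n, hn⟩ := hex
    obtain ⟨m, hm⟩ := D.achain_congr h i hk
    exact ⟨n - m, by push_cast; linarith⟩
  obtain ⟨-, ⟨h0, hs, horb, hstep⟩, hcond⟩ := h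
  by_cases hz : ∃ k ≤ s, coroot i (c k) = 0
  · obtain ⟨k, hk, hk0⟩ := hz
    exact ⟨k, hk, 0, by simp [hk0]⟩
  push Not at hz
  have hneg : coroot i (c 0) < 0 := lt_of_le_of_ne (h0 ▸ hμ) (hz 0 (by omega))
  have hcross : ∃ k < s, coroot i (c k) < 0 ∧ 0 < coroot i (c (k + 1)) := by
    by_contra hno
    push Not at hno
    have hall : ∀ k ≤ s, coroot i (c k) < 0 := by
      intro k
      induction k with
      | zero => exact fun _ => hneg
      | succ k ih =>
        intro hk
        exact lt_of_le_of_ne (hno k hk (ih (by omega))) (hz _ hk)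
    have := hall s le_rfl
    rw [hs] at this
    linarith
  obtain ⟨k, hk, hk1, hk2⟩ := hcross
  obtain ⟨-, hβ, hpos, hc⟩ := hstep k hk
  obtain ⟨⟨l, hpres⟩, hdist, hre, -⟩ := hcond k hk
  obtain ⟨hA, hβv⟩ := D.cover_sign_change hi hpres hβ hpos hc (horb k hk.le) (horb (k + 1) hk)
    hdist hk1 hk2
  obtain ⟨n, -, hn⟩ := hre hA
  exact ⟨k + 1, hk, n, by rw [← hβv]; simpa using hn⟩

end IsDatum

/-- The piecewise linear function with breakpoints `a k` and slopes `y k`. -/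
def plSum (a y : ℕ → ℚ) (s : ℕ) (t : ℚ) : ℚ :=
  ∑ k ∈ Finset.range s, max (min t (a (k + 1)) - a k) 0 * y k

lemma hFun_glsPath (lamseq : ℕ → V) (a : ℕ → ℚ) (s : ℕ) (i : I) (t : ℚ) :
    hFun coroot i (glsPath lamseq a s) t = plSum a (fun k => coroot i (lamseq (k + 1))) s t := by
  simp [hFun, glsPath, plSum, map_sum]

section PiecewiseLinear

variable {a y : ℕ → ℚ} {s : ℕ}

lemma breakpoints_mono (ha : ∀ k < s, a k < a (k + 1)) {j k : ℕ} (hjk : j ≤ k) (hk : k ≤ s) :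
    a j ≤ a k := by
  induction k, hjk using Nat.le_induction with
  | base => exact le_rfl
  | succ k _ ih => exact (ih (by omega)).trans (ha k hk).le

lemma plSum_eq (ha : ∀ k < s, a k < a (k + 1)) {j : ℕ} (hj : j < s) {t : ℚ} (h1 : a j ≤ t)
    (h2 : t ≤ a (j + 1)) : plSum a y s t = plSum a y s (a j) + (t - a j) * y j := by
  rw [← sub_eq_iff_eq_add', plSum, plSum, ← Finset.sum_sub_distrib, Finset.sum_eq_single j]
  · rw [min_eq_left h2, min_eq_left (h1.trans h2), max_eq_left (by linarith), sub_self, max_self]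
    ring
  · intro k hk hkj
    have hks := Finset.mem_range.1 hk
    rcases lt_or_gt_of_ne hkj with hlt | hgt
    · have h3 := breakpoints_mono ha (show k + 1 ≤ j from hlt) hj.le
      rw [min_eq_right (h3.trans h1), min_eq_right h3, sub_self]
    · have h3 := breakpoints_mono ha (show j + 1 ≤ k from hgt) hks.le
      have h4 := ha k hks
      rw [min_eq_left (by linarith), min_eq_left (by linarith), max_eq_right (by linarith),
        max_eq_right (by linarith), sub_self]
  · exact fun h => absurd (Finset.mem_range.2 hj) h

lemma plSum_zero (ha : ∀ k < s, a k < a (k + 1)) : plSum a y s (a 0) = 0 := by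
  refine Finset.sum_eq_zero fun k hk => ?_
  have hks := Finset.mem_range.1 hk
  have h3 := breakpoints_mono ha (Nat.zero_le k) hks.le
  have h4 := ha k hks
  rw [min_eq_left (by linarith), max_eq_right (by linarith), zero_mul]

lemma exists_segment (h0 : a 0 = 0) (h1 : a s = 1) {t : ℚ} (ht0 : 0 < t) (ht1 : t ≤ 1) :
    ∃ j < s, a j < t ∧ t ≤ a (j + 1) := by
  classical
  have hex : ∃ j, t ≤ a j := ⟨s, h1 ▸ ht1⟩
  obtain ⟨j, hj⟩ : ∃ j, Nat.find hex = j + 1 := by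
    refine Nat.exists_eq_succ_of_ne_zero fun h => ?_
    have := Nat.find_spec hex
    rw [h, h0] at this
    linarith
  have hmin := Nat.find_min hex (m := j) (by omega)
  have hle : Nat.find hex ≤ s := Nat.find_min' hex (h1 ▸ ht1)
  have hspec := Nat.find_spec hex
  rw [hj] at hspec
  exact ⟨j, by omega, not_le.1 hmin, hspec⟩

/-- Near an interior point, a piecewise linear function has a left and a right slope; they can
differ only at a breakpoint. -/
lemma exists_local_slopes (ha : ∀ k < s, a k < a (k + 1)) (h0 : a 0 = 0) (h1 : a s = 1) {t₀ : ℚ}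
    (ht0 : 0 < t₀) (ht1 : t₀ < 1) : ∃ yl yr δ : ℚ, 0 < δ ∧
      (∀ t, t₀ - δ ≤ t → t ≤ t₀ → plSum a y s t = plSum a y s t₀ - (t₀ - t) * yl) ∧
      (∀ t, t₀ ≤ t → t ≤ t₀ + δ → plSum a y s t = plSum a y s t₀ + (t - t₀) * yr) ∧
      (yl = yr ∨ ∃ j, j + 1 < s ∧ t₀ = a (j + 1) ∧ yl = y j ∧ yr = y (j + 1)) := by
  obtain ⟨j, hj, hl, hr⟩ := exists_segment h0 h1 ht0 ht1.le
  have hleft : ∀ t, a j ≤ t → t ≤ t₀ →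
      plSum a y s t = plSum a y s t₀ - (t₀ - t) * y j := by
    intro t h2 h3
    rw [plSum_eq ha hj h2 (h3.trans hr), plSum_eq ha hj hl.le hr]
    ring
  rcases lt_or_eq_of_le hr with hlt | heq
  · refine ⟨y j, y j, min (t₀ - a j) (a (j + 1) - t₀), lt_min (by linarith) (by linarith),
      fun t h2 h3 => hleft t ?_ h3, fun t h2 h3 => ?_, Or.inl rfl⟩
    · linarith [min_le_left (t₀ - a j) (a (j + 1) - t₀)]
    · rw [plSum_eq ha hj (t := t) (by linarith)
        (by linarith [min_le_right (t₀ - a j) (a (j + 1) - t₀)]), plSum_eq ha hj hl.le hr]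
      ring
  · have hjs : j + 1 < s := by
      refine lt_of_le_of_ne hj fun h => ?_
      rw [h, h1] at heq
      linarith
    have hlt := ha (j + 1) hjs
    refine ⟨y j, y (j + 1), min (t₀ - a j) (a (j + 2) - t₀),
      lt_min (by linarith) (by linarith), fun t h2 h3 => hleft t ?_ h3, fun t h2 h3 => ?_,
      Or.inr ⟨j, hjs, heq, rfl, rfl⟩⟩
    · linarith [min_le_left (t₀ - a j) (a (j + 2) - t₀)]
    · rw [heq] at h2 ⊢
      exact plSum_eq ha hjs h2 (by
        linarith [min_le_right (t₀ - a j) (a (j + 2) - t₀)])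

/-- A piecewise linear function on `[0,1]` attains its minimum at a breakpoint. -/
lemma exists_min_breakpoint (ha : ∀ k < s, a k < a (k + 1)) (h0 : a 0 = 0) (h1 : a s = 1) :
    ∃ j ≤ s, ∀ t, 0 ≤ t → t ≤ 1 → plSum a y s (a j) ≤ plSum a y s t := by
  obtain ⟨j, hj, hmin⟩ := Finset.exists_min_image (Finset.range (s + 1))
    (fun j => plSum a y s (a j)) ⟨0, by simp⟩
  have hmin' : ∀ k ≤ s, plSum a y s (a j) ≤ plSum a y s (a k) := fun k hk =>
    hmin k (Finset.mem_range.2 (by omega))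
  refine ⟨j, by simpa [Nat.lt_succ_iff] using hj, fun t ht0 ht1 => ?_⟩
  rcases ht0.eq_or_lt with rfl | ht0
  · exact h0 ▸ hmin' 0 (Nat.zero_le s)
  obtain ⟨k, hk, hkl, hkr⟩ := exists_segment h0 h1 ht0 ht1
  have e1 := plSum_eq (y := y) ha hk hkl.le hkr
  have e2 := plSum_eq (y := y) ha hk (ha k hk).le le_rfl
  have m1 := hmin' k hk.le
  have m2 := hmin' (k + 1) hk
  rcases le_total 0 (y k) with hy | hy
  · rw [e1]
    nlinarith
  · have : plSum a y s (a (k + 1)) ≤ plSum a y s t := by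
      rw [e1, e2]
      nlinarith
    linarith

end PiecewiseLinear

namespace IsDatum

variable {lam : V} {s : ℕ} {lamseq : ℕ → V} {a : ℕ → ℚ}

lemma plSum_breakpoint_congr (D : IsDatum A α coroot)
    (hgls : IsGLS A α coroot lam s lamseq a) (i : I) {j : ℕ} (hj : j < s) :
    ∃ n : ℤ, plSum a (fun k => coroot i (lamseq (k + 1))) s (a (j + 1)) =
      a (j + 1) * coroot i (lamseq (j + 1)) + n := by
  obtain ⟨-, h0, -, ha, -, hch, -⟩ := hgls
  induction j with
  | zero =>
    refine ⟨0, ?_⟩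
    rw [plSum_eq ha hj (ha 0 hj).le le_rfl, plSum_zero ha, h0]
    simp
  | succ j ih =>
    obtain ⟨n, hn⟩ := ih (by omega)
    obtain ⟨m, hm⟩ := D.hasAChain_congr (hch (j + 1) (by omega) hj) i
    refine ⟨n - m, ?_⟩
    rw [plSum_eq ha hj (ha (j + 1) hj).le le_rfl, hn]
    push_cast
    linarith

/-- At a breakpoint where a real simple coroot changes sign from `≤ 0` to `≥ 0`, the height
function is an integer. -/
lemma plSum_breakpoint_int (D : IsDatum A α coroot)
    (hgls : IsGLS A α coroot lam s lamseq a) {i : I} (hi : A i i = 2) {j : ℕ} (hj : j + 1 < s)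
    (hl : coroot i (lamseq (j + 1)) ≤ 0) (hr : 0 ≤ coroot i (lamseq (j + 1 + 1))) :
    ∃ n : ℤ, plSum a (fun k => coroot i (lamseq (k + 1))) s (a (j + 1)) = n := by
  obtain ⟨n, hn⟩ := D.plSum_breakpoint_congr hgls i (j := j) (by omega)
  obtain ⟨m, hm⟩ := D.hasAChain_int (hgls.2.2.2.2.2.1 (j + 1) (by omega) hj) hi hl hr
  exact ⟨m + n, by rw [hn, hm]; push_cast; rfl⟩

lemma hFun_localMin_int (D : IsDatum A α coroot)
    (hgls : IsGLS A α coroot lam s lamseq a) {i : I} (hi : A i i = 2) {t₀ ε : ℚ} (ht0 : 0 < t₀)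
    (ht1 : t₀ < 1) (hε : 0 < ε)
    (hl : ∀ t, t₀ - ε ≤ t → t < t₀ →
      hFun coroot i (glsPath lamseq a s) t₀ ≤ hFun coroot i (glsPath lamseq a s) t)
    (hr : ∀ t, t₀ < t → t ≤ t₀ + ε →
      hFun coroot i (glsPath lamseq a s) t₀ ≤ hFun coroot i (glsPath lamseq a s) t)
    (hstrict : (∀ t, t₀ - ε ≤ t → t < t₀ →
      hFun coroot i (glsPath lamseq a s) t₀ < hFun coroot i (glsPath lamseq a s) t) ∨
      ∀ t, t₀ < t → t ≤ t₀ + ε →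
      hFun coroot i (glsPath lamseq a s) t₀ < hFun coroot i (glsPath lamseq a s) t) :
    ∃ n : ℤ, hFun coroot i (glsPath lamseq a s) t₀ = n := by
  simp only [hFun_glsPath] at *
  have hgls' := hgls
  obtain ⟨-, h0, h1, ha, -⟩ := hgls'
  obtain ⟨yl, yr, δ, hδ, hL, hR, hcase⟩ := exists_local_slopes
    (y := fun k => coroot i (lamseq (k + 1))) ha h0 h1 ht0 ht1
  set η := min δ ε with hη
  have hη0 : 0 < η := lt_min hδ hε
  have hηδ : η ≤ δ := min_le_left _ _
  have hηε : η ≤ ε := min_le_right _ _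
  have eL := hL (t₀ - η) (by linarith) (by linarith)
  have eR := hR (t₀ + η) (by linarith) (by linarith)
  have iL := hl (t₀ - η) (by linarith) (by linarith)
  have iR := hr (t₀ + η) (by linarith) (by linarith)
  rw [eL] at iL
  rw [eR] at iR
  have hyl : yl ≤ 0 := by
    by_contra h
    nlinarith [mul_pos hη0 (not_le.1 h)]
  have hyr : 0 ≤ yr := by
    by_contra h
    nlinarith [mul_pos hη0 (neg_pos.2 (not_le.1 h))]
  rcases hcase with heq | ⟨j, hj, rfl, rfl, rfl⟩
  · exfalso
    have hz : yl = 0 := le_antisymm hyl (heq ▸ hyr)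
    rcases hstrict with h | h
    · have := h (t₀ - η) (by linarith) (by linarith)
      rw [eL, hz] at this
      linarith
    · have := h (t₀ + η) (by linarith) (by linarith)
      rw [eR, ← heq, hz] at this
      linarith
  · exact D.plSum_breakpoint_int hgls hi hj hyl hyr

lemma exists_int_min (D : IsDatum A α coroot) (hlam : lam ∈ Pplus coroot)
    (hgls : IsGLS A α coroot lam s lamseq a) (i : I) :
    ∃ t₀ : ℚ, 0 ≤ t₀ ∧ t₀ ≤ 1 ∧
      (∀ t : ℚ, 0 ≤ t → t ≤ 1 →
        hFun coroot i (glsPath lamseq a s) t₀ ≤ hFun coroot i (glsPath lamseq a s) t) ∧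
      ∃ n : ℤ, hFun coroot i (glsPath lamseq a s) t₀ = n := by
  simp only [hFun_glsPath]
  have hgls' := hgls
  obtain ⟨-, h0, h1, ha, horb, -⟩ := hgls'
  set y : ℕ → ℚ := fun k => coroot i (lamseq (k + 1)) with hy
  by_cases hi : A i i = 2
  · obtain ⟨j, hj, hmin⟩ := exists_min_breakpoint (y := y) ha h0 h1
    have hrange : ∀ k ≤ s, 0 ≤ a k ∧ a k ≤ 1 := fun k hk =>
      ⟨h0 ▸ breakpoints_mono ha (Nat.zero_le k) hk, h1 ▸ breakpoints_mono ha hk le_rfl⟩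
    refine ⟨a j, (hrange j hj).1, (hrange j hj).2, hmin, ?_⟩
    rcases j with - | j
    · exact ⟨0, by rw [plSum_zero ha]; simp⟩
    rcases hj.eq_or_lt with hjs | hjs
    · obtain ⟨n, hn⟩ := D.plSum_breakpoint_congr hgls i (j := j) hj
      obtain ⟨m, hm⟩ := D.coroot_Torbit_int hlam (horb (j + 1) (by omega) hj) i
      refine ⟨m + n, ?_⟩
      rw [hn, hjs, h1, ← hjs, hm]
      push_cast
      ring
    · have e1 := plSum_eq (y := y) ha hj (ha j hj).le le_rfl
      have e2 := plSum_eq (y := y) ha hjs (ha (j + 1) hjs).le le_rfl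
      have m1 := hmin (a j) (hrange j (by omega)).1 (hrange j (by omega)).2
      have m2 := hmin (a (j + 1 + 1)) (hrange _ hjs).1 (hrange _ hjs).2
      have d1 := ha j hj
      have d2 := ha (j + 1) hjs
      refine D.plSum_breakpoint_int hgls hi hjs ?_ ?_
      · change y j ≤ 0
        by_contra h
        nlinarith [mul_pos (sub_pos.2 d1) (not_le.1 h)]
      · change 0 ≤ y (j + 1)
        by_contra h
        nlinarith [mul_pos (sub_pos.2 d2) (neg_pos.2 (not_le.1 h))]
  · refine ⟨0, le_rfl, zero_le_one, fun t _ _ => ?_, 0, ?_⟩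
    · rw [← h0, plSum_zero ha]
      refine Finset.sum_nonneg fun k hk => mul_nonneg (le_max_right _ _) ?_
      exact D.coroot_Torbit_nonneg hlam
        (horb (k + 1) (by omega) (Finset.mem_range.1 hk)) hi
    · rw [← h0, plSum_zero ha]
      simp

end IsDatum

lemma mOf_eq {i : I} {π : ℚ → V} {t₀ : ℚ} {n : ℤ} (h0 : 0 ≤ t₀) (h1 : t₀ ≤ 1)
    (hmin : ∀ t : ℚ, 0 ≤ t → t ≤ 1 → hFun coroot i π t₀ ≤ hFun coroot i π t)
    (hn : hFun coroot i π t₀ = n) : mOf coroot i π = n := by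
  have hleast : IsLeast {n : ℤ | ∃ t, 0 ≤ t ∧ t ≤ 1 ∧ hFun coroot i π t = (n : ℚ)} n := by
    refine ⟨⟨t₀, h0, h1, hn⟩, ?_⟩
    rintro m ⟨t, ht0, ht1, hm⟩
    have := hmin t ht0 ht1
    rw [hn, hm] at this
    exact_mod_cast this
  exact hleast.csInf_eq

end GKM

open GKM in
/-- For a GLS path `π` and a real index `i`, the value of `h_i^π` at any (left or
right) local minimum `t₀ ∈ (0,1)` is an integer; consequently every GLS path is
integral: for every `i ∈ I` the minimum of `h_i^π` on `[0,1]` is attained and equals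
the integer `m_i^π`. -/
theorem stmt14 {I V : Type*} [Countable I] [AddCommGroup V] [Module ℚ V]
    (A : I → I → ℤ) (α : I → V) (coroot : I → (V →ₗ[ℚ] ℚ))
    (hind : LinearIndependent ℚ α)
    (hpair : ∀ i j, coroot i (α j) = (A i j : ℚ))
    (hdiag : ∀ i, A i i = 2 ∨ A i i ≤ 0)
    (hoff : ∀ i j, i ≠ j → A i j ≤ 0)
    (hzero : ∀ i j, A i j = 0 ↔ A j i = 0)
    (lam : V) (hlam : lam ∈ Pplus coroot)
    (s : ℕ) (lamseq : ℕ → V) (a : ℕ → ℚ)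
    (hgls : IsGLS A α coroot lam s lamseq a) :
    (∀ (i : I), A i i = 2 → ∀ t₀ ε : ℚ, 0 < t₀ → t₀ < 1 → 0 < ε →
      (∀ t t' : ℚ, t₀ - ε ≤ t → t < t' → t' ≤ t₀ →
        hFun coroot i (glsPath lamseq a s) t' <
          hFun coroot i (glsPath lamseq a s) t) →
      (∀ t t' : ℚ, t₀ ≤ t → t ≤ t' → t' ≤ t₀ + ε →
        hFun coroot i (glsPath lamseq a s) t ≤
          hFun coroot i (glsPath lamseq a s) t') →
      ∃ n : ℤ, hFun coroot i (glsPath lamseq a s) t₀ = (n : ℚ)) ∧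
    (∀ (i : I), A i i = 2 → ∀ t₀ ε : ℚ, 0 < t₀ → t₀ < 1 → 0 < ε →
      (∀ t t' : ℚ, t₀ - ε ≤ t → t ≤ t' → t' ≤ t₀ →
        hFun coroot i (glsPath lamseq a s) t' ≤
          hFun coroot i (glsPath lamseq a s) t) →
      (∀ t t' : ℚ, t₀ ≤ t → t < t' → t' ≤ t₀ + ε →
        hFun coroot i (glsPath lamseq a s) t <
          hFun coroot i (glsPath lamseq a s) t') →
      ∃ n : ℤ, hFun coroot i (glsPath lamseq a s) t₀ = (n : ℚ)) ∧
    (∀ i : I, ∃ t₀ : ℚ, 0 ≤ t₀ ∧ t₀ ≤ 1 ∧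
      (∀ t : ℚ, 0 ≤ t → t ≤ 1 →
        hFun coroot i (glsPath lamseq a s) t₀ ≤
          hFun coroot i (glsPath lamseq a s) t) ∧
      hFun coroot i (glsPath lamseq a s) t₀ =
        (mOf coroot i (glsPath lamseq a s) : ℚ)) := by
  have D : IsDatum A α coroot := ⟨hind, hpair, hdiag, hoff, hzero⟩
  refine ⟨fun i hi t₀ ε ht0 ht1 hε hl hr => ?_, fun i hi t₀ ε ht0 ht1 hε hl hr => ?_,
    fun i => ?_⟩
  · exact D.hFun_localMin_int hgls hi ht0 ht1 hε (fun t h h' => (hl t t₀ h h' le_rfl).le)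
      (fun t h h' => hr t₀ t le_rfl h.le h') (Or.inl fun t h h' => hl t t₀ h h' le_rfl)
  · exact D.hFun_localMin_int hgls hi ht0 ht1 hε (fun t h h' => hl t t₀ h h'.le le_rfl)
      (fun t h h' => (hr t₀ t le_rfl h h').le) (Or.inr fun t h h' => hr t₀ t le_rfl h h')
  · obtain ⟨t₀, h0, h1, hmin, n, hn⟩ := D.exists_int_min hlam hgls i
    exact ⟨t₀, h0, h1, hmin, by rw [hn, mOf_eq h0 h1 hmin hn]⟩
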